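/- arXiv:1804.03154 — 4 statements merged into one kernel-verified Lean document; each statement's English description precedes it below -/
import Mathlib

section
/- Let (ν_d, ν_d^□)_{d ∈ ℕ} be a sequence of pairs of Borel probability measures on ℝ such that (i) each ν_d has finite absolute moments of all orders and each ν_d^□ is compactly supported, (ii) for every k ∈ ℕ, |m_k(ν_d) − m_k(ν_d^□)| → 0 as d → ∞, where m_k(μ) = ∫ x^k μ(dx), and (iii) there is M > 0 with supp(ν_d^□) ⊆ [−M, M] for all d. Then for every bounded continuous function f : ℝ → ℝ and every real polynomial p, we have |∫ f(x) p(x) ν_d(dx) − ∫ f(x) p(x) ν_d^□(dx)| → 0 as d → ∞. -/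
open MeasureTheory Filter

lemma abs_le_one_add_sq (a : ℝ) : |a| ≤ 1 + a ^ 2 := by
  rw [← sq_abs a]
  nlinarith [sq_nonneg (|a| - 1), abs_nonneg a]

lemma integrable_polynomial_eval {μ : Measure ℝ} (h : ∀ k : ℕ, Integrable (fun x : ℝ => x ^ k) μ)
    (q : Polynomial ℝ) : Integrable (fun x => q.eval x) μ := by
  simp only [Polynomial.eval_eq_sum_range]
  exact integrable_finsetSum _ fun i _ => (h i).const_mul _

lemma integral_polynomial_eval {μ : Measure ℝ} (h : ∀ k : ℕ, Integrable (fun x : ℝ => x ^ k) μ)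
    (q : Polynomial ℝ) :
    ∫ x, q.eval x ∂μ = ∑ i ∈ Finset.range (q.natDegree + 1), q.coeff i * ∫ x : ℝ, x ^ i ∂μ := by
  simp only [Polynomial.eval_eq_sum_range]
  rw [integral_finsetSum _ fun i _ => (h i).const_mul _]
  simp only [integral_const_mul]

lemma integrable_of_continuous_of_measure_compl_Icc_eq_zero {μ : Measure ℝ} [IsFiniteMeasure μ]
    {a b : ℝ} (h : μ (Set.Icc a b)ᶜ = 0) {g : ℝ → ℝ} (hg : Continuous g) : Integrable g μ := by
  have hi : IntegrableOn g (Set.Icc a b) μ := hg.continuousOn.integrableOn_compact isCompact_Icc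
  rwa [IntegrableOn, Measure.restrict_eq_self_of_ae_mem (s := Set.Icc a b) (mem_ae_iff.2 h)] at hi

lemma tendsto_integral_polynomial_eval_sub {μ η : ℕ → Measure ℝ}
    (hμ : ∀ d (k : ℕ), Integrable (fun x : ℝ => x ^ k) (μ d))
    (hη : ∀ d (k : ℕ), Integrable (fun x : ℝ => x ^ k) (η d))
    (hconv : ∀ k : ℕ,
      Tendsto (fun d => (∫ x : ℝ, x ^ k ∂μ d) - ∫ x : ℝ, x ^ k ∂η d) atTop (nhds 0))
    (q : Polynomial ℝ) :
    Tendsto (fun d => (∫ x, q.eval x ∂μ d) - ∫ x, q.eval x ∂η d) atTop (nhds 0) := by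
  simp only [integral_polynomial_eval (hμ _), integral_polynomial_eval (hη _),
    ← Finset.sum_sub_distrib, ← mul_sub]
  simpa using tendsto_finsetSum (Finset.range (q.natDegree + 1))
    fun i _ => (hconv i).const_mul (q.coeff i)

/-- A continuous function dominated by a polynomial is approximated by a polynomial on the whole
line, up to a polynomial error that is small on a prescribed interval. -/
lemma exists_polynomial_abs_sub_le {h : ℝ → ℝ} (hh : Continuous h) {D : Polynomial ℝ}
    (hD : ∀ x, |h x| ≤ D.eval x) {M : ℝ} (hM : 0 < M) {ε : ℝ} (hε : 0 < ε) :
    ∃ q T : Polynomial ℝ, (∀ x, |h x - q.eval x| ≤ ε + T.eval x) ∧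
      ∀ x ∈ Set.Icc (-M) M, T.eval x ≤ ε := by
  obtain ⟨q, hq⟩ := exists_polynomial_near_of_continuousOn (-(2 * M)) (2 * M) h hh.continuousOn ε hε
  set G : Polynomial ℝ := D + 1 + q ^ 2 with hG
  have hGh : ∀ x, |h x - q.eval x| ≤ G.eval x := fun x => by
    have h1 := abs_sub (h x) (q.eval x)
    have h2 := abs_le_one_add_sq (q.eval x)
    simp only [hG, Polynomial.eval_add, Polynomial.eval_one, Polynomial.eval_pow]
    linarith [hD x]
  have hG0 : ∀ x, 0 ≤ G.eval x := fun x => (abs_nonneg _).trans (hGh x)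
  obtain ⟨B, hB⟩ := (isCompact_Icc (a := -M) (b := M)).exists_bound_of_continuousOn
    G.continuous.continuousOn
  have hlim : Tendsto (fun N : ℕ => B * (1 / 4 : ℝ) ^ N) atTop (nhds 0) := by
    simpa using (tendsto_pow_atTop_nhds_zero_of_lt_one (by norm_num : (0 : ℝ) ≤ 1 / 4)
      (by norm_num)).const_mul B
  obtain ⟨N, hN⟩ := (hlim.eventually (ge_mem_nhds hε)).exists
  refine ⟨q, G * (Polynomial.C (1 / (2 * M)) ^ 2 * Polynomial.X ^ 2) ^ N,
    fun x => ?_, fun x hx => ?_⟩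
  all_goals
    simp only [Polynomial.eval_mul, Polynomial.eval_pow, Polynomial.eval_C, Polynomial.eval_X]
    have hy : (1 / (2 * M)) ^ 2 * x ^ 2 = x ^ 2 / (4 * M ^ 2) := by ring
    rw [hy]
  · have hp : 0 ≤ x ^ 2 / (4 * M ^ 2) := by positivity
    by_cases hx : x ∈ Set.Icc (-(2 * M)) (2 * M)
    · have h1 := hq x hx
      rw [abs_sub_comm] at h1
      have h2 := mul_nonneg (hG0 x) (pow_nonneg hp N)
      linarith
    · have h1 : 1 ≤ x ^ 2 / (4 * M ^ 2) := by
        rw [one_le_div (by positivity)]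
        by_contra! hlt
        exact hx (abs_le.1 (abs_le_of_sq_le_sq (by nlinarith) (by positivity)))
      have h2 := le_mul_of_one_le_right (hG0 x) (one_le_pow₀ h1 (n := N))
      linarith [hGh x]
  · refine le_trans ?_ hN
    have h1 : x ^ 2 / (4 * M ^ 2) ≤ 1 / 4 := by
      rw [div_le_div_iff₀ (by positivity) (by positivity)]
      nlinarith [hx.1, hx.2]
    have h2 : G.eval x ≤ B := (le_abs_self _).trans (hB x hx)
    have h3 := (hG0 x).trans h2
    gcongr

open MeasureTheory Filter

theorem stmt11 (ν νb : ℕ → Measure ℝ)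
    [∀ d, IsProbabilityMeasure (ν d)] [∀ d, IsProbabilityMeasure (νb d)]
    (hmom : ∀ d k, Integrable (fun x : ℝ => |x| ^ k) (ν d))
    (M : ℝ) (hM : 0 < M) (hsupp : ∀ d, νb d (Set.Icc (-M) M)ᶜ = 0)
    (hconv : ∀ k : ℕ,
      Tendsto (fun d => |(∫ x : ℝ, x ^ k ∂ν d) - ∫ x : ℝ, x ^ k ∂νb d|) atTop (nhds 0))
    (f : ℝ → ℝ) (hf : Continuous f) (hfb : ∃ C : ℝ, ∀ x : ℝ, |f x| ≤ C)
    (p : Polynomial ℝ) :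
    Tendsto (fun d =>
        |(∫ x : ℝ, f x * p.eval x ∂ν d) - ∫ x : ℝ, f x * p.eval x ∂νb d|)
      atTop (nhds 0) := by
  obtain ⟨C, hC⟩ := hfb
  have hμ : ∀ d (k : ℕ), Integrable (fun x : ℝ => x ^ k) (ν d) := fun d k =>
    (hmom d k).mono' (by fun_prop) (ae_of_all _ fun x => by simp)
  have hη : ∀ d {g : ℝ → ℝ}, Continuous g → Integrable g (νb d) := fun d _ hg =>
    integrable_of_continuous_of_measure_compl_Icc_eq_zero (hsupp d) hg
  have hpoly := tendsto_integral_polynomial_eval_sub hμ (fun d k => hη d (continuous_pow k))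
    fun k => (tendsto_zero_iff_abs_tendsto_zero _).2 (hconv k)
  set h : ℝ → ℝ := fun x => f x * p.eval x with hh_def
  have hh : Continuous h := hf.mul p.continuous
  set D : Polynomial ℝ := Polynomial.C C * (1 + p ^ 2) with hD_def
  have hD : ∀ x, |h x| ≤ D.eval x := fun x => by
    simp only [hh_def, hD_def, abs_mul, Polynomial.eval_mul, Polynomial.eval_C,
      Polynomial.eval_add, Polynomial.eval_one, Polynomial.eval_pow]
    exact mul_le_mul (hC x) (abs_le_one_add_sq _) (abs_nonneg _) ((abs_nonneg _).trans (hC x))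
  have hint : ∀ d, Integrable h (ν d) := fun d =>
    (integrable_polynomial_eval (hμ d) D).mono' hh.aestronglyMeasurable (ae_of_all _ hD)
  refine (tendsto_zero_iff_abs_tendsto_zero _).1 (Metric.tendsto_nhds.2 fun ε hε => ?_)
  obtain ⟨q, T, hqT, hT⟩ := exists_polynomial_abs_sub_le hh hD hM (by positivity : 0 < ε / 6)
  have key : ∀ (μ : Measure ℝ) [IsProbabilityMeasure μ], Integrable h μ →
      (∀ r : Polynomial ℝ, Integrable (fun x => r.eval x) μ) →
      |(∫ x, h x ∂μ) - ∫ x, q.eval x ∂μ| ≤ ε / 6 + ∫ x, T.eval x ∂μ := by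
    intro μ _ hi hr
    rw [← integral_sub hi (hr q)]
    calc |∫ x, h x - q.eval x ∂μ| ≤ ∫ x, |h x - q.eval x| ∂μ := abs_integral_le_integral_abs
      _ ≤ ∫ x, ε / 6 + T.eval x ∂μ :=
        integral_mono (hi.sub (hr q)).abs ((integrable_const _).add (hr T)) hqT
      _ = ε / 6 + ∫ x, T.eval x ∂μ := by
        rw [integral_add (integrable_const _) (hr T)]; simp
  filter_upwards [Metric.tendsto_nhds.1 (hpoly q) (ε / 6) (by positivity),
    Metric.tendsto_nhds.1 (hpoly T) (ε / 6) (by positivity)] with d hq_d hT_d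
  have hTb : ∫ x, T.eval x ∂νb d ≤ ε / 6 := by
    calc ∫ x, T.eval x ∂νb d ≤ ∫ _, ε / 6 ∂νb d :=
        integral_mono_ae (hη d T.continuous) (integrable_const _)
          (Filter.mem_of_superset (mem_ae_iff.2 (hsupp d)) hT)
      _ = ε / 6 := by simp
  have h1 := abs_le.1 (key (ν d) (hint d) (integrable_polynomial_eval (hμ d)))
  have h2 := abs_le.1 (key (νb d) (hη d hh) fun r => hη d r.continuous)
  rw [Real.dist_0_eq_abs, abs_lt] at hq_d hT_d ⊢
  constructor <;> linarith [h1.1, h1.2, h2.1, h2.2, hq_d.1, hq_d.2, hT_d.1, hT_d.2]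
end

section
/- Let 𝔄 be a unital C*-algebra. For a ∈ 𝔄 write Im a = (a − a*)/(2i). Let Z, W ∈ 𝔄 and ε > 0 be such that Im Z ≥ ε·1 and Im W ≤ 0. Then Z − W is invertible in 𝔄 and ‖(Z − W)^{-1}‖ ≤ ‖(Im Z)^{-1}‖. -/
/-- The imaginary part `Im a = (a − a*)/(2i)` of an element of a complex star algebra. -/
noncomputable def imPart {A : Type*} [CStarAlgebra A] (a : A) : A :=
  (2 * Complex.I)⁻¹ • (a - star a)

lemma imPart_sub {A : Type*} [CStarAlgebra A] (a b : A) :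
    imPart (a - b) = imPart a - imPart b := by
  simp only [imPart, star_sub, ← smul_sub]
  congr 1
  abel

lemma norm_imPart_le {A : Type*} [CStarAlgebra A] (a : A) : ‖imPart a‖ ≤ ‖a‖ := by
  have h : ‖a - star a‖ ≤ 2 * ‖a‖ := by
    simpa [two_mul] using norm_sub_le a (star a)
  rw [imPart, norm_smul]
  have h2 : ‖(2 * Complex.I)⁻¹‖ = 2⁻¹ := by simp
  rw [h2]
  linarith

lemma exists_isSelfAdjoint_add_I_smul_imPart {A : Type*} [CStarAlgebra A] (a : A) :
    ∃ x : A, IsSelfAdjoint x ∧ a = x + Complex.I • imPart a := by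
  refine ⟨(2⁻¹ : ℂ) • (a + star a), ?_, ?_⟩
  · rw [IsSelfAdjoint, star_smul, star_add, star_star, add_comm]
    simp
  · have h : Complex.I * (2 * Complex.I)⁻¹ = 2⁻¹ := by
      field_simp
    rw [imPart, smul_smul, h, ← smul_add, add_add_sub_cancel, ← two_smul ℂ a, smul_smul]
    norm_num

lemma IsSelfAdjoint.isUnit_add_I_smul_one {A : Type*} [CStarAlgebra A] {x : A}
    (hx : IsSelfAdjoint x) : IsUnit (x + Complex.I • (1 : A)) := by
  have h : -Complex.I ∉ spectrum ℂ x := fun h ↦ by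
    have := congrArg Complex.im (hx.mem_spectrum_eq_re h)
    simp at this
  rw [spectrum.notMem_iff] at h
  have h' := h.neg
  rwa [Algebra.algebraMap_eq_smul_one, neg_smul, neg_sub, sub_neg_eq_add] at h'

lemma isUnit_of_isStrictlyPositive_imPart {A : Type*} [CStarAlgebra A] [PartialOrder A]
    [StarOrderedRing A] {a : A} (ha : IsStrictlyPositive (imPart a)) : IsUnit a := by
  obtain ⟨x, hx, hax⟩ := exists_isSelfAdjoint_add_I_smul_imPart a
  set k := imPart a
  set r : A := k ^ (-(1 / 2) : ℝ)
  have hr : IsSelfAdjoint r := IsSelfAdjoint.of_nonneg CFC.rpow_nonneg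
  have hrk : r * k * r = 1 := CFC.conjugate_rpow_neg_one_half k
  have hru : IsUnit r := (IsStrictlyPositive.rpow k _ ha).isUnit
  have hrar : r * a * r = r * x * r + Complex.I • (1 : A) := by
    rw [hax, mul_add, add_mul, mul_smul_comm, smul_mul_assoc, hrk]
  have h : IsUnit (r * a * r) := by
    rw [hrar]
    refine IsSelfAdjoint.isUnit_add_I_smul_one ?_
    simpa [hr.star_eq] using hx.conjugate r
  rwa [hru.mul_right_iff, hru.mul_left_iff] at h

lemma one_le_norm_inverse_smul {A : Type*} [CStarAlgebra A] [PartialOrder A]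
    [StarOrderedRing A] {p : A} (hp : IsStrictlyPositive p) :
    1 ≤ ‖Ring.inverse p‖ • p := by
  have hs : IsSelfAdjoint (CFC.sqrt p) := IsSelfAdjoint.of_nonneg (CFC.sqrt_nonneg p)
  have hss : CFC.sqrt p * CFC.sqrt p = p := CFC.sqrt_mul_sqrt_self p hp.nonneg
  have hi : IsSelfAdjoint (Ring.inverse p) := by
    rw [IsSelfAdjoint, ← Ring.inverse_star, hp.isSelfAdjoint.star_eq]
  have h := CStarAlgebra.star_left_conjugate_le_norm_smul (a := CFC.sqrt p) hi
  have hc : Commute (CFC.sqrt p) (Ring.inverse p) := by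
    have hcp : Commute (CFC.sqrt p) p := by
      simpa only [hss] using (Commute.refl (CFC.sqrt p)).mul_right (Commute.refl _)
    obtain ⟨u, rfl⟩ := hp.isUnit
    rw [Ring.inverse_unit]
    exact hcp.units_inv_right
  rw [hs.star_eq, hc.eq, mul_assoc, hss, Ring.inverse_mul_cancel _ hp.isUnit] at h
  exact h

lemma star_inverse_mul_imPart_mul_inverse {A : Type*} [CStarAlgebra A] {a : A} (ha : IsUnit a) :
    star (Ring.inverse a) * imPart a * Ring.inverse a = -imPart (Ring.inverse a) := by
  have h := Ring.mul_inverse_cancel a ha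
  have h' : star (Ring.inverse a) * star a = 1 := by rw [← star_mul, h, star_one]
  rw [imPart, imPart, mul_smul_comm, smul_mul_assoc, mul_sub, sub_mul, h', mul_assoc, h, one_mul,
    mul_one, ← smul_neg, neg_sub]

theorem stmt14 {A : Type*} [CStarAlgebra A] [PartialOrder A] [StarOrderedRing A]
    (Z W : A) (ε : ℝ) (hε : 0 < ε)
    (hZ : (ε : ℂ) • (1 : A) ≤ imPart Z) (hW : imPart W ≤ 0) :
    IsUnit (Z - W) ∧ ‖Ring.inverse (Z - W)‖ ≤ ‖Ring.inverse (imPart Z)‖ := by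
  have hP : IsStrictlyPositive (imPart Z) := by
    refine IsStrictlyPositive.of_le ?_ hZ
    have : IsStrictlyPositive (ε • (1 : A)) := isStrictlyPositive_one.smul hε
    simpa using this
  have hle : imPart Z ≤ imPart (Z - W) := by
    rw [imPart_sub]
    exact le_sub_self_iff _ |>.2 hW
  have hu : IsUnit (Z - W) := isUnit_of_isStrictlyPositive_imPart (hP.of_le hle)
  refine ⟨hu, ?_⟩
  set S := Ring.inverse (Z - W)
  set m := ‖Ring.inverse (imPart Z)‖
  have h1 : star S * S ≤ m • -imPart S := calc
    star S * S = star S * 1 * S := by rw [mul_one]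
    _ ≤ star S * (m • imPart (Z - W)) * S :=
      star_left_conjugate_le_conjugate
        ((one_le_norm_inverse_smul hP).trans (smul_le_smul_of_nonneg_left hle (norm_nonneg _))) S
    _ = m • -imPart S := by
      rw [mul_smul_comm, smul_mul_assoc, star_inverse_mul_imPart_mul_inverse hu]
  have h2 : ‖S‖ * ‖S‖ ≤ m * ‖S‖ := calc
    ‖S‖ * ‖S‖ = ‖star S * S‖ := CStarRing.norm_star_mul_self.symm
    _ ≤ ‖m • -imPart S‖ := CStarAlgebra.norm_le_norm_of_nonneg_of_le (star_mul_self_nonneg S) h1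
    _ = m * ‖imPart S‖ := by rw [norm_smul, norm_neg, norm_norm]
    _ ≤ m * ‖S‖ := by gcongr; exact norm_imPart_le S
  rcases (norm_nonneg S).eq_or_lt with h0 | h0
  · rw [← h0]; exact norm_nonneg _
  · exact le_of_mul_le_mul_right h2 h0
end

section
/- Let p, d ∈ ℕ with d ≥ 1, v ∈ ℝ^p, and z ∈ ℂ with Im z > max{|v_k| : k = 1, …, p}. Define 𝒢_{z,v}(b) = (z − R(b, v))^{-1} where R(b, v) = (1/d)·Σ_{i=1}^p v_i/(1 − v_i·b). Then 𝒢_{z,v} maps ℍ⁻ = {b ∈ ℂ : Im b < 0} into itself, the fixed point equation b = 𝒢_{z,v}(b) has a unique solution G*(z, v) ∈ ℍ⁻, and for every initial point b₀ ∈ ℍ⁻ the iterates 𝒢_{z,v}^{∘n}(b₀) converge to G*(z, v) as n → ∞. -/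
open Filter

/-- The compound Wishart R-map `R(b, v) = (1/d)·Σ_{i=1}^p v_i/(1 − v_i·b)`. -/
noncomputable def cwR (d : ℕ) {p : ℕ} (v : Fin p → ℝ) (b : ℂ) : ℂ :=
  (1 / (d : ℂ)) * ∑ i : Fin p, (v i : ℂ) / (1 - (v i : ℂ) * b)

/-- The quantity `|b - c|² / (Im b · Im c)`, which for `b`, `c` in the same half plane is a
monotone function of their hyperbolic distance. -/
noncomputable def hypQuot (b c : ℂ) : ℝ :=
  Complex.normSq (b - c) / (b.im * c.im)

lemma normSq_sub_eq_hypQuot_mul {b c : ℂ} (hb : b.im < 0) (hc : c.im < 0) :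
    Complex.normSq (b - c) = hypQuot b c * (b.im * c.im) := by
  rw [hypQuot, div_mul_cancel₀ _ (mul_pos_of_neg_of_neg hb hc).ne']

lemma hypQuot_nonneg {b c : ℂ} (hb : b.im < 0) (hc : c.im < 0) : 0 ≤ hypQuot b c :=
  div_nonneg (Complex.normSq_nonneg _) (mul_pos_of_neg_of_neg hb hc).le

/-- The Möbius map `w ↦ w⁻¹` preserves `hypQuot`. -/
lemma hypQuot_inv {w u : ℂ} (hw : w ≠ 0) (hu : u ≠ 0) : hypQuot w⁻¹ u⁻¹ = hypQuot w u := by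
  have hw' : Complex.normSq w ≠ 0 := by simpa using hw
  have hu' : Complex.normSq u ≠ 0 := by simpa using hu
  have h : w⁻¹ - u⁻¹ = (u - w) * (w⁻¹ * u⁻¹) := by field_simp
  have hs : Complex.normSq (u - w) = Complex.normSq (w - u) := by
    rw [← Complex.normSq_neg, neg_sub]
  have h1 : (w⁻¹).im * (u⁻¹).im = (w.im * u.im) * (Complex.normSq w * Complex.normSq u)⁻¹ := by
    rw [Complex.inv_im, Complex.inv_im]
    field_simp
  rw [hypQuot, hypQuot, h, h1, map_mul, map_mul, Complex.normSq_inv, Complex.normSq_inv, hs,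
    ← mul_inv, mul_div_mul_right _ _ (inv_ne_zero (mul_ne_zero hw' hu'))]

lemma norm_sub_le_of_hypQuot_le {b c : ℂ} {ρ q : ℝ} (hb : b.im < 0) (hc : c.im < 0)
    (hbρ : ‖b‖ ≤ ρ) (hcρ : ‖c‖ ≤ ρ) (hq : hypQuot b c ≤ q) : ‖b - c‖ ≤ √q * ρ := by
  have hρ : 0 ≤ ρ := (norm_nonneg b).trans hbρ
  have hq0 : 0 ≤ q := (hypQuot_nonneg hb hc).trans hq
  have h1 : -b.im ≤ ρ := (neg_le_abs _).trans ((Complex.abs_im_le_norm b).trans hbρ)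
  have h2 : -c.im ≤ ρ := (neg_le_abs _).trans ((Complex.abs_im_le_norm c).trans hcρ)
  refine abs_le_of_sq_le_sq' ?_ (by positivity) |>.2
  rw [mul_pow, Real.sq_sqrt hq0, ← Complex.normSq_eq_norm_sq, normSq_sub_eq_hypQuot_mul hb hc]
  have h3 : b.im * c.im ≤ ρ ^ 2 := by nlinarith
  exact mul_le_mul hq h3 (mul_pos_of_neg_of_neg hb hc).le hq0

lemma hypQuot_iterate_le {f : ℂ → ℂ} {T : Set ℂ} {κ : ℝ} (hf : Set.MapsTo f T T)
    (hκ : ∀ b ∈ T, ∀ c ∈ T, hypQuot (f b) (f c) ≤ κ ^ 2 * hypQuot b c) {b c : ℂ}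
    (hb : b ∈ T) (hc : c ∈ T) (n : ℕ) :
    hypQuot (f^[n] b) (f^[n] c) ≤ (κ ^ n) ^ 2 * hypQuot b c := by
  induction n with
  | zero => simp
  | succ n ih =>
    rw [Function.iterate_succ_apply', Function.iterate_succ_apply']
    calc _ ≤ κ ^ 2 * hypQuot (f^[n] b) (f^[n] c) := hκ _ (hf.iterate n hb) _ (hf.iterate n hc)
      _ ≤ κ ^ 2 * ((κ ^ n) ^ 2 * hypQuot b c) := by gcongr
      _ = _ := by ring

lemma norm_iterate_sub_iterate_le {f : ℂ → ℂ} {ρ κ : ℝ}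
    (hf : Set.MapsTo f {b | b.im < 0 ∧ ‖b‖ ≤ ρ} {b | b.im < 0 ∧ ‖b‖ ≤ ρ}) (hκ0 : 0 ≤ κ)
    (hκ : ∀ b ∈ {b : ℂ | b.im < 0 ∧ ‖b‖ ≤ ρ}, ∀ c ∈ {b : ℂ | b.im < 0 ∧ ‖b‖ ≤ ρ},
      hypQuot (f b) (f c) ≤ κ ^ 2 * hypQuot b c) {b c : ℂ}
    (hb : b.im < 0 ∧ ‖b‖ ≤ ρ) (hc : c.im < 0 ∧ ‖c‖ ≤ ρ) (n : ℕ) :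
    ‖f^[n] b - f^[n] c‖ ≤ √(hypQuot b c) * ρ * κ ^ n := by
  have h := norm_sub_le_of_hypQuot_le (hf.iterate n hb).1 (hf.iterate n hc).1
    (hf.iterate n hb).2 (hf.iterate n hc).2 (hypQuot_iterate_le hf hκ hb hc n)
  rw [Real.sqrt_mul (sq_nonneg _), Real.sqrt_sq (pow_nonneg hκ0 n)] at h
  linarith

/-- A map of the half disc into itself which contracts `hypQuot` uniformly and whose image stays
away from the real line has an attracting fixed point. -/
lemma exists_fixedPoint_of_hypQuot_le {f : ℂ → ℂ} {ρ κ ε : ℝ} (hρ : 0 < ρ) (hε : 0 < ε)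
    (hf : Set.MapsTo f {b | b.im < 0 ∧ ‖b‖ ≤ ρ} {b | b.im < 0 ∧ ‖b‖ ≤ ρ})
    (hfε : ∀ b : ℂ, b.im < 0 → ‖b‖ ≤ ρ → (f b).im ≤ -ε)
    (hfc : ∀ b : ℂ, b.im < 0 → ContinuousAt f b) (hκ0 : 0 ≤ κ) (hκ1 : κ < 1)
    (hκ : ∀ b ∈ {b : ℂ | b.im < 0 ∧ ‖b‖ ≤ ρ}, ∀ c ∈ {b : ℂ | b.im < 0 ∧ ‖b‖ ≤ ρ},
      hypQuot (f b) (f c) ≤ κ ^ 2 * hypQuot b c) :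
    ∃ g : ℂ, g.im < 0 ∧ f g = g ∧
      ∀ b : ℂ, b.im < 0 → ‖b‖ ≤ ρ → Tendsto (fun n => f^[n] b) atTop (nhds g) := by
  set b₀ : ℂ := -(ρ : ℂ) * Complex.I with hb₀
  have hb₀T : b₀.im < 0 ∧ ‖b₀‖ ≤ ρ := by simp [hb₀, hρ, abs_of_pos hρ]
  have hcauchy : CauchySeq fun n => f^[n] b₀ := by
    refine cauchySeq_of_le_geometric κ (√(hypQuot b₀ (f b₀)) * ρ) hκ1 fun n => ?_
    rw [dist_eq_norm, Function.iterate_succ_apply]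
    exact norm_iterate_sub_iterate_le hf hκ0 hκ hb₀T (hf hb₀T) n
  obtain ⟨g, hg⟩ := cauchySeq_tendsto_of_complete hcauchy
  have hg1 : Tendsto (fun n => f (f^[n] b₀)) atTop (nhds g) := by
    simpa only [Function.iterate_succ_apply'] using (tendsto_add_atTop_iff_nat 1).2 hg
  have hgε : g.im ≤ -ε :=
    le_of_tendsto ((Complex.continuous_im.tendsto g).comp hg1)
      (Eventually.of_forall fun n => hfε _ (hf.iterate n hb₀T).1 (hf.iterate n hb₀T).2)
  have hgρ : ‖g‖ ≤ ρ :=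
    le_of_tendsto hg.norm (Eventually.of_forall fun n => (hf.iterate n hb₀T).2)
  have hg0 : g.im < 0 := by linarith
  have hfix : f g = g := tendsto_nhds_unique ((hfc g hg0).tendsto.comp hg) hg1
  refine ⟨g, hg0, hfix, fun b hb hbρ => ?_⟩
  rw [tendsto_iff_norm_sub_tendsto_zero]
  have hlim : Tendsto (fun n => √(hypQuot b g) * ρ * κ ^ n) atTop (nhds 0) := by
    simpa using (tendsto_pow_atTop_nhds_zero_of_lt_one hκ0 hκ1).const_mul (√(hypQuot b g) * ρ)
  refine squeeze_zero (fun n => norm_nonneg _) (fun n => ?_) hlim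
  have h := norm_iterate_sub_iterate_le hf hκ0 hκ ⟨hb, hbρ⟩ ⟨hg0, hgρ⟩ n
  rwa [Function.iterate_fixed hfix] at h

/-- The ratio `Im R(b, v) / Im b`. -/
noncomputable def cwRSlope (d : ℕ) {p : ℕ} (v : Fin p → ℝ) (b : ℂ) : ℝ :=
  (1 / (d : ℝ)) * ∑ i : Fin p, v i ^ 2 / Complex.normSq (1 - (v i : ℂ) * b)

lemma cwRSlope_nonneg (d : ℕ) {p : ℕ} (v : Fin p → ℝ) (b : ℂ) : 0 ≤ cwRSlope d v b :=
  mul_nonneg (by positivity)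
    (Finset.sum_nonneg fun _ _ => div_nonneg (sq_nonneg _) (Complex.normSq_nonneg _))

lemma cwR_im (d : ℕ) {p : ℕ} (v : Fin p → ℝ) (b : ℂ) :
    (cwR d v b).im = b.im * cwRSlope d v b := by
  have h : (1 / (d : ℂ)) = ((1 / (d : ℝ) : ℝ) : ℂ) := by push_cast; rfl
  rw [cwR, cwRSlope, h, Complex.im_ofReal_mul, Complex.im_sum, mul_left_comm,
    Finset.mul_sum _ _ b.im]
  congr 1
  refine Finset.sum_congr rfl fun i _ => ?_
  simp only [Complex.div_im, Complex.ofReal_im, Complex.ofReal_re, Complex.sub_im,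
    Complex.one_im, Complex.im_ofReal_mul]
  ring

lemma one_sub_ofReal_mul_ne_zero (x : ℝ) {b : ℂ} (hb : b.im ≠ 0) : 1 - (x : ℂ) * b ≠ 0 := by
  intro h
  have him := congrArg Complex.im h
  simp only [Complex.sub_im, Complex.one_im, Complex.im_ofReal_mul, Complex.zero_im, zero_sub,
    neg_eq_zero, mul_eq_zero, hb, or_false] at him
  simp [him] at h

lemma continuousAt_cwR (d : ℕ) {p : ℕ} (v : Fin p → ℝ) {b : ℂ}
    (hb : ∀ i, 1 - (v i : ℂ) * b ≠ 0) : ContinuousAt (cwR d v) b := by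
  unfold cwR
  refine continuousAt_const.mul (tendsto_finsetSum _ fun i _ => ?_)
  exact ContinuousAt.div (by fun_prop) (by fun_prop) (hb i)

lemma normSq_cwR_sub_le (d : ℕ) {p : ℕ} (v : Fin p → ℝ) {b c : ℂ}
    (hb : b.im ≠ 0) (hc : c.im ≠ 0) :
    Complex.normSq (cwR d v b - cwR d v c) ≤
      Complex.normSq (b - c) * (cwRSlope d v b * cwRSlope d v c) := by
  have h : cwR d v b - cwR d v c = (1 / (d : ℂ)) * ((b - c) *
      ∑ i : Fin p, ((v i : ℂ) / (1 - (v i : ℂ) * b)) * ((v i : ℂ) / (1 - (v i : ℂ) * c))) := by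
    rw [cwR, cwR, ← mul_sub, ← Finset.sum_sub_distrib, Finset.mul_sum _ _ (b - c)]
    congr 1
    refine Finset.sum_congr rfl fun i _ => ?_
    have := one_sub_ofReal_mul_ne_zero (v i) hb
    have := one_sub_ofReal_mul_ne_zero (v i) hc
    field_simp
    ring
  have hn (x : ℝ) (e : ℂ) : ‖(x : ℂ) / (1 - (x : ℂ) * e)‖ ^ 2 =
      x ^ 2 / Complex.normSq (1 - (x : ℂ) * e) := by
    rw [norm_div, div_pow, Complex.normSq_eq_norm_sq, Complex.norm_real, Real.norm_eq_abs, sq_abs]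
  have hcs : ‖∑ i : Fin p,
      ((v i : ℂ) / (1 - (v i : ℂ) * b)) * ((v i : ℂ) / (1 - (v i : ℂ) * c))‖ ^ 2 ≤
      (∑ i : Fin p, v i ^ 2 / Complex.normSq (1 - (v i : ℂ) * b)) *
        ∑ i : Fin p, v i ^ 2 / Complex.normSq (1 - (v i : ℂ) * c) := by
    simp only [← hn]
    refine le_trans ?_ (Finset.sum_mul_sq_le_sq_mul_sq _ _ _)
    gcongr
    refine (norm_sum_le _ _).trans_eq ?_
    simp only [norm_mul]
  rw [h, map_mul, map_mul, Complex.normSq_eq_norm_sq (∑ i : Fin p, _), cwRSlope, cwRSlope,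
    map_div₀, map_one, Complex.normSq_natCast]
  calc _ ≤ 1 / ((d : ℝ) * d) * (Complex.normSq (b - c) *
        ((∑ i : Fin p, v i ^ 2 / Complex.normSq (1 - (v i : ℂ) * b)) *
        ∑ i : Fin p, v i ^ 2 / Complex.normSq (1 - (v i : ℂ) * c))) :=
        mul_le_mul_of_nonneg_left
          (mul_le_mul_of_nonneg_left hcs (Complex.normSq_nonneg _)) (by positivity)
    _ = _ := by ring

lemma im_le_im_sub_cwR (d : ℕ) {p : ℕ} (v : Fin p → ℝ) (z : ℂ) {b : ℂ} (hb : b.im < 0) :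
    z.im ≤ (z - cwR d v b).im := by
  rw [Complex.sub_im, cwR_im]
  nlinarith [cwRSlope_nonneg d v b]

/-- Where `R` is bounded by `M`, the map `b ↦ (z - R(b, v))⁻¹` contracts `hypQuot` by the factor
`(M / (Im z + M))²`. -/
lemma hypQuot_inv_sub_cwR_le (d : ℕ) {p : ℕ} (v : Fin p → ℝ) {z b c : ℂ} {M : ℝ}
    (hz : 0 < z.im) (hb : b.im < 0) (hc : c.im < 0)
    (hbM : ‖cwR d v b‖ ≤ M) (hcM : ‖cwR d v c‖ ≤ M) :
    hypQuot (z - cwR d v b)⁻¹ (z - cwR d v c)⁻¹ ≤ (M / (z.im + M)) ^ 2 * hypQuot b c := by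
  have hM : 0 ≤ M := (norm_nonneg _).trans hbM
  have key {e : ℂ} (he : e.im < 0) (heM : ‖cwR d v e‖ ≤ M) :
      z - cwR d v e ≠ 0 ∧ 0 < (z - cwR d v e).im ∧
      -e.im * cwRSlope d v e ≤ M / (z.im + M) * (z - cwR d v e).im := by
    have hpos := hz.trans_le (im_le_im_sub_cwR d v z he)
    refine ⟨fun h => by simp [h] at hpos, hpos, ?_⟩
    have h1 : -e.im * cwRSlope d v e ≤ M := by
      rw [neg_mul, ← cwR_im]
      exact (neg_le_abs _).trans ((Complex.abs_im_le_norm _).trans heM)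
    rw [Complex.sub_im, cwR_im, div_mul_eq_mul_div, le_div_iff₀ (by positivity)]
    nlinarith
  obtain ⟨hwb, hb1, hb2⟩ := key hb hbM
  obtain ⟨hwc, hc1, hc2⟩ := key hc hcM
  have hprod := mul_le_mul hb2 hc2
    (mul_nonneg (by linarith) (cwRSlope_nonneg d v c)) (by positivity)
  rw [hypQuot_inv hwb hwc, hypQuot, div_le_iff₀ (mul_pos hb1 hc1)]
  have hs : Complex.normSq ((z - cwR d v b) - (z - cwR d v c)) =
      Complex.normSq (cwR d v b - cwR d v c) := by
    rw [← Complex.normSq_neg]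
    congr 1
    ring
  rw [hs]
  refine (normSq_cwR_sub_le d v hb.ne hc.ne).trans ?_
  rw [normSq_sub_eq_hypQuot_mul hb hc]
  have := mul_le_mul_of_nonneg_left hprod (hypQuot_nonneg hb hc)
  linarith

theorem stmt17 (p d : ℕ) (hd : 1 ≤ d) (v : Fin p → ℝ) (z : ℂ)
    (hz0 : 0 < z.im) (hz : ∀ k : Fin p, |v k| < z.im) :
    Set.MapsTo (fun b : ℂ => (z - cwR d v b)⁻¹) {b : ℂ | b.im < 0} {b : ℂ | b.im < 0} ∧
    ∃ g : ℂ, g.im < 0 ∧ (z - cwR d v g)⁻¹ = g ∧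
      (∀ b : ℂ, b.im < 0 → (z - cwR d v b)⁻¹ = b → b = g) ∧
      ∀ b₀ : ℂ, b₀.im < 0 →
        Tendsto (fun n => (fun b : ℂ => (z - cwR d v b)⁻¹)^[n] b₀) atTop (nhds g) := by
  set f : ℂ → ℂ := fun b => (z - cwR d v b)⁻¹ with hf
  have hne {b : ℂ} (hb : b.im < 0) : z - cwR d v b ≠ 0 := fun h => by
    have := im_le_im_sub_cwR d v z hb
    rw [h, Complex.zero_im] at this
    linarith
  have him {b : ℂ} (hb : b.im < 0) : (f b).im < 0 := by
    rw [hf, Complex.inv_im]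
    exact div_neg_of_neg_of_pos (by linarith [im_le_im_sub_cwR d v z hb])
      (Complex.normSq_pos.2 (hne hb))
  have hnorm {b : ℂ} (hb : b.im < 0) : ‖f b‖ ≤ z.im⁻¹ := by
    rw [hf, norm_inv]
    exact inv_anti₀ hz0 ((im_le_im_sub_cwR d v z hb).trans (Complex.im_le_norm _))
  have hball : ContinuousOn (cwR d v) (Metric.closedBall 0 z.im⁻¹) := by
    refine fun b hb => (continuousAt_cwR d v fun i h => ?_).continuousWithinAt
    rw [mem_closedBall_zero_iff] at hb
    have h1 : ‖(v i : ℂ) * b‖ = 1 := by rw [← sub_eq_zero.1 h, norm_one]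
    rw [norm_mul, Complex.norm_real, Real.norm_eq_abs] at h1
    have h2 : |v i| * ‖b‖ ≤ |v i| * z.im⁻¹ := mul_le_mul_of_nonneg_left hb (abs_nonneg _)
    have h3 : |v i| * z.im⁻¹ < 1 := by
      rw [← div_eq_mul_inv, div_lt_one hz0]
      exact hz i
    linarith
  obtain ⟨M, hM⟩ := (isCompact_closedBall (0 : ℂ) z.im⁻¹).exists_bound_of_continuousOn hball
  simp only [mem_closedBall_zero_iff] at hM
  have hM0 : 0 ≤ M := (norm_nonneg _).trans (hM 0 (by simpa using hz0.le))
  have hzpos : 0 < ‖z‖ := hz0.trans_le (Complex.im_le_norm z)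
  obtain ⟨g, hg, hfix, hlim⟩ := exists_fixedPoint_of_hypQuot_le (f := f) (ρ := z.im⁻¹)
    (κ := M / (z.im + M)) (ε := z.im / (‖z‖ + M) ^ 2) (by positivity) (by positivity)
    (fun b hb => ⟨him hb.1, hnorm hb.1⟩)
    (fun b hb hbρ => by
      rw [hf, Complex.inv_im, neg_div, neg_le_neg_iff, Complex.normSq_eq_norm_sq]
      have him' := im_le_im_sub_cwR d v z hb
      have hle : ‖z - cwR d v b‖ ≤ ‖z‖ + M :=
        (norm_sub_le _ _).trans (by linarith [hM b hbρ])
      exact div_le_div₀ (hz0.le.trans him') him' (pow_pos (norm_pos_iff.2 (hne hb)) 2)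
        (pow_le_pow_left₀ (norm_nonneg _) hle 2))
    (fun b hb => (continuousAt_const.sub (continuousAt_cwR d v fun i =>
      one_sub_ofReal_mul_ne_zero _ hb.ne)).inv₀ (hne hb))
    (by positivity) ((div_lt_one (by positivity)).2 (by linarith))
    (fun b hb c hc => hypQuot_inv_sub_cwR_le d v hz0 hb.1 hc.1 (hM b hb.2) (hM c hc.2))
  have hlim' (b : ℂ) (hb : b.im < 0) : Tendsto (fun n => f^[n] b) atTop (nhds g) :=
    (tendsto_add_atTop_iff_nat 1).1 (hlim (f b) (him hb) (hnorm hb))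
  refine ⟨fun b hb => him hb, g, hg, hfix, fun b hb hbf => ?_, hlim'⟩
  refine tendsto_nhds_unique tendsto_const_nhds ((hlim' b hb).congr fun n => ?_)
  exact Function.iterate_fixed hbf n
end

section
/- Let p, d ∈ ℕ, X ∈ M_{p,d}(ℂ), and z ∈ ℂ with Im z > 0. Let w = √z be the branch of the square root with Re w ≥ 0 and Im w > 0. Let Λ(X) ∈ M_{p+d}(ℂ) be the self-adjoint block matrix with blocks [[O_d, X*], [X, O_p]] (upper-left d×d zero block, upper-right X*, lower-left X, lower-right p×p zero block). Then z·I_d − X*X and w·I_{p+d} − Λ(X) are both invertible, and (z·I_d − X*X)^{-1} = (1/w)·[(w·I_{p+d} − Λ(X))^{-1}]_{+,+}, where [M]_{+,+} denotes the upper-left d×d corner block of M ∈ M_{p+d}(ℂ). In particular, taking normalized traces, (1/d)·Tr[(z·I_d − X*X)^{-1}] = (1/w)·(1/d)·Tr[ ((w·I_{p+d} − Λ(X))^{-1})_{+,+} ]. -/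
open Matrix

theorem Matrix.IsHermitian.isUnit_smul_one_sub {n : Type*} [Fintype n] [DecidableEq n]
    {A : Matrix n n ℂ} (hA : A.IsHermitian) {z : ℂ} (hz : z.im ≠ 0) :
    IsUnit (z • (1 : Matrix n n ℂ) - A) := by
  have h : z ∉ spectrum ℂ A := by
    rw [hA.spectrum_eq_image_range]
    rintro ⟨r, -, rfl⟩
    exact hz (Complex.ofReal_im r)
  rwa [spectrum.notMem_iff, Algebra.algebraMap_eq_smul_one] at h

/-- The upper-left corner of the resolvent at `w` of the linearization of `B * C` is
`w` times the resolvent of `B * C` at `w ^ 2`. -/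
theorem Matrix.inv_sq_smul_one_sub_mul {K m n : Type*} [Field K]
    [Fintype m] [DecidableEq m] [Fintype n] [DecidableEq n]
    (B : Matrix m n K) (C : Matrix n m K) {w : K} (hw : w ≠ 0)
    (h : IsUnit (w • (1 : Matrix (m ⊕ n) (m ⊕ n) K) - fromBlocks 0 B C 0)) :
    (w ^ 2 • (1 : Matrix m m K) - B * C)⁻¹ =
      (1 / w) • ((w • (1 : Matrix (m ⊕ n) (m ⊕ n) K) - fromBlocks 0 B C 0)⁻¹).toBlocks₁₁ := by
  apply inv_eq_right_inv
  have hR := mul_nonsing_inv _ ((isUnit_iff_isUnit_det _).mp h)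
  set R := (w • (1 : Matrix (m ⊕ n) (m ⊕ n) K) - fromBlocks 0 B C 0)⁻¹
  have hM : w • (1 : Matrix (m ⊕ n) (m ⊕ n) K) - fromBlocks 0 B C 0 =
      fromBlocks (w • 1) (-B) (-C) (w • 1) := by
    rw [← fromBlocks_one, fromBlocks_smul, sub_eq_add_neg, fromBlocks_neg, fromBlocks_add]
    simp
  rw [hM, ← fromBlocks_toBlocks R, fromBlocks_multiply, ← fromBlocks_one, fromBlocks_inj] at hR
  obtain ⟨h₁₁, -, h₂₁, -⟩ := hR
  have h₂₁' : C * R.toBlocks₁₁ = w • R.toBlocks₂₁ := by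
    rw [Matrix.neg_mul, Matrix.smul_mul, Matrix.one_mul, neg_add_eq_zero] at h₂₁
    exact h₂₁
  rw [Matrix.mul_smul, Matrix.sub_mul, Matrix.mul_assoc, h₂₁', Matrix.mul_smul, Matrix.smul_mul, Matrix.one_mul, sq,
    ← smul_smul, ← smul_sub, smul_smul, one_div, inv_mul_cancel₀ hw, one_smul, ← h₁₁]
  simp [sub_eq_add_neg]

theorem stmt18 (p d : ℕ) (hd : 1 ≤ d) (X : Matrix (Fin p) (Fin d) ℂ) (z w : ℂ)
    (hz : 0 < z.im) (hw : w ^ 2 = z) (hwre : 0 ≤ w.re) (hwim : 0 < w.im) :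
    IsUnit (z • (1 : Matrix (Fin d) (Fin d) ℂ) - Xᴴ * X) ∧
    IsUnit (w • (1 : Matrix (Fin d ⊕ Fin p) (Fin d ⊕ Fin p) ℂ) -
      Matrix.fromBlocks 0 Xᴴ X 0) ∧
    (z • (1 : Matrix (Fin d) (Fin d) ℂ) - Xᴴ * X)⁻¹ =
      (1 / w) • ((w • (1 : Matrix (Fin d ⊕ Fin p) (Fin d ⊕ Fin p) ℂ) -
        Matrix.fromBlocks 0 Xᴴ X 0)⁻¹).toBlocks₁₁ ∧
    (1 / (d : ℂ)) * Matrix.trace (z • (1 : Matrix (Fin d) (Fin d) ℂ) - Xᴴ * X)⁻¹ =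
      (1 / w) * ((1 / (d : ℂ)) * Matrix.trace
        (((w • (1 : Matrix (Fin d ⊕ Fin p) (Fin d ⊕ Fin p) ℂ) -
          Matrix.fromBlocks 0 Xᴴ X 0)⁻¹).toBlocks₁₁)) := by
  have hw0 : w ≠ 0 := by
    rintro rfl
    exact hwim.ne rfl
  have hΛ : (Matrix.fromBlocks 0 Xᴴ X 0 : Matrix (Fin d ⊕ Fin p) (Fin d ⊕ Fin p) ℂ).IsHermitian :=
    isHermitian_zero.fromBlocks (conjTranspose_conjTranspose X) isHermitian_zero
  have hunit := hΛ.isUnit_smul_one_sub hwim.ne'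
  have hinv := Matrix.inv_sq_smul_one_sub_mul Xᴴ X hw0 hunit
  rw [hw] at hinv
  refine ⟨(isHermitian_conjTranspose_mul_self X).isUnit_smul_one_sub hz.ne', hunit, hinv, ?_⟩
  rw [hinv, trace_smul, smul_eq_mul]
  ring
end
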